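/- Let (Ω,F,P) be a non-atomic probability space, G ⊆ F a sub-σ-algebra, u1, u2 ∈ U⁺_icx and α ∈ (0,1). If X, X1, X2, … ∈ L∞(F) and Xn ↑ X P-a.s. as n → ∞, then ρ_α^G(Xn) ↑ ρ_α^G(X) P-a.s. as n → ∞. -/

import Mathlib

open MeasureTheory Set Filter Topology

variable {Ω : Type*}

/-- `Z ∈ L∞(𝒢)`: `Z` is `𝒢`-measurable and bounded. -/
def BddMeas (𝒢 : MeasurableSpace Ω) (Z : Ω → ℝ) : Prop :=
  Measurable[𝒢] Z ∧ ∃ C : ℝ, ∀ ω, |Z ω| ≤ C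

/-- `u ∈ U⁺_icx`: `u` is strictly increasing and convex on `[0,∞)` with `u 0 = 0`, `u 1 = 1`. -/
def Uicx (u : ℝ → ℝ) : Prop :=
  StrictMonoOn u (Set.Ici 0) ∧ ConvexOn ℝ (Set.Ici 0) u ∧ u 0 = 0 ∧ u 1 = 1

/-- `π_α(X,Z) = α·E[u1((X−Z)⁺)] + (1−α)·E[u2((X−Z)⁻)]`. -/
noncomputable def piRisk {mΩ : MeasurableSpace Ω} (P : Measure Ω) (u1 u2 : ℝ → ℝ) (α : ℝ)
    (X Z : Ω → ℝ) : ℝ :=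
  α * ∫ ω, u1 (max (X ω - Z ω) 0) ∂P + (1 - α) * ∫ ω, u2 (max (Z ω - X ω) 0) ∂P

/-- The set of minimizers of `Z ↦ π_α(X,Z)` over `L∞(𝒢)`. -/
def ArgminSet {mΩ : MeasurableSpace Ω} (P : Measure Ω) (𝒢 : MeasurableSpace Ω)
    (u1 u2 : ℝ → ℝ) (α : ℝ) (X : Ω → ℝ) : Set (Ω → ℝ) :=
  {Z | BddMeas 𝒢 Z ∧ ∀ W, BddMeas 𝒢 W → piRisk P u1 u2 α X Z ≤ piRisk P u1 u2 α X W}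

/-- `ρ` is an essential infimum of the family `S` of random variables in the a.s. order. -/
def IsEssInf {mΩ : MeasurableSpace Ω} (P : Measure Ω) (S : Set (Ω → ℝ)) (ρ : Ω → ℝ) : Prop :=
  (∀ Z ∈ S, ρ ≤ᵐ[P] Z) ∧ ∀ W : Ω → ℝ, (∀ Z ∈ S, W ≤ᵐ[P] Z) → W ≤ᵐ[P] ρ

/-- The probability space is non-atomic. -/
def Nonatomic {mΩ : MeasurableSpace Ω} (P : Measure Ω) : Prop :=
  ∀ A : Set Ω, MeasurableSet[mΩ] A → 0 < P A →
    ∃ B ⊆ A, MeasurableSet[mΩ] B ∧ 0 < P B ∧ P B < P A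

/-- The acceptance set of the conditional shortfall risk measure:
`{Z ∈ L∞(𝒢) : E[v(X−Z)|𝒢] ≤ 0 a.s.}`. -/
def ShortfallSet {mΩ : MeasurableSpace Ω} (P : Measure Ω) (𝒢 : MeasurableSpace Ω)
    (v : ℝ → ℝ) (X : Ω → ℝ) : Set (Ω → ℝ) :=
  {Z | BddMeas 𝒢 Z ∧ ∀ᵐ ω ∂P, (P[fun ω' => v (X ω' - Z ω')|𝒢]) ω ≤ 0}

/-- Left derivative of `u` at `x`, multiplied by the indicator of `{x > 0}`. -/
noncomputable def ldInd (u : ℝ → ℝ) (x : ℝ) : ℝ :=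
  if 0 < x then derivWithin u (Set.Iic x) x else 0

/-- Right derivative of `u` at `x`, multiplied by the indicator of `{x ≥ 0}`. -/
noncomputable def rdInd (u : ℝ → ℝ) (x : ℝ) : ℝ :=
  if 0 ≤ x then derivWithin u (Set.Ici x) x else 0

/-- The function `v` built from `u1, u2, α`: `v(x) = α·(u1)'_−(x)` for `x > 0` and
`v(x) = −(1−α)·(u2)'_+(−x)` for `x ≤ 0`. -/
noncomputable def vFun (u1 u2 : ℝ → ℝ) (α : ℝ) (x : ℝ) : ℝ :=
  if 0 < x then α * derivWithin u1 (Set.Iic x) x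
  else -((1 - α) * derivWithin u2 (Set.Ici (-x)) (-x))

/-- `ρ` is a conditional convex risk measure: monotone, conditionally translation
invariant, conditionally convex and normalized. -/
def IsCondConvexRM {mΩ : MeasurableSpace Ω} (P : Measure Ω) (𝒢 : MeasurableSpace Ω)
    (ρ : (Ω → ℝ) → (Ω → ℝ)) : Prop :=
  (∀ X Y : Ω → ℝ, BddMeas mΩ X → BddMeas mΩ Y → X ≤ᵐ[P] Y → ρ X ≤ᵐ[P] ρ Y) ∧
  (∀ X Z : Ω → ℝ, BddMeas mΩ X → BddMeas 𝒢 Z →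
      ρ (fun ω => X ω + Z ω) =ᵐ[P] fun ω => ρ X ω + Z ω) ∧
  (∀ X Y Λ : Ω → ℝ, BddMeas mΩ X → BddMeas mΩ Y → BddMeas 𝒢 Λ →
      (∀ᵐ ω ∂P, 0 ≤ Λ ω ∧ Λ ω ≤ 1) →
      ρ (fun ω => Λ ω * X ω + (1 - Λ ω) * Y ω) ≤ᵐ[P]
        fun ω => Λ ω * ρ X ω + (1 - Λ ω) * ρ Y ω) ∧
  (ρ (fun _ => 0) =ᵐ[P] fun _ => 0)

/-- `ρ` is a conditional coherent risk measure: a conditional convex risk measure that is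
conditionally positively homogeneous. -/
def IsCondCoherentRM {mΩ : MeasurableSpace Ω} (P : Measure Ω) (𝒢 : MeasurableSpace Ω)
    (ρ : (Ω → ℝ) → (Ω → ℝ)) : Prop :=
  IsCondConvexRM P 𝒢 ρ ∧
  ∀ X Λ : Ω → ℝ, BddMeas mΩ X → BddMeas 𝒢 Λ → (∀ᵐ ω ∂P, 0 ≤ Λ ω) →
    ρ (fun ω => Λ ω * X ω) =ᵐ[P] fun ω => Λ ω * ρ X ω

/-- `𝒢` is generated by a finite measurable partition of `Ω`, each cell having positive
probability. -/
def FinitePartitionGen {mΩ : MeasurableSpace Ω} (P : Measure Ω)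
    (𝒢 : MeasurableSpace Ω) : Prop :=
  ∃ (n : ℕ) (A : Fin n → Set Ω),
    (∀ i, MeasurableSet[mΩ] (A i)) ∧ (∀ i, 0 < P (A i)) ∧
    Pairwise (Function.onFun Disjoint A) ∧ (⋃ i, A i) = Set.univ ∧
    𝒢 = MeasurableSpace.generateFrom {s | ∃ i, s = A i}

/-- The convex function with `π_α(X,Z) = E[φ(X - Z)]`. -/
noncomputable def phiFun (u1 u2 : ℝ → ℝ) (α t : ℝ) : ℝ :=
  α * u1 (max t 0) + (1 - α) * u2 (max (-t) 0)

theorem gpart_convex {u : ℝ → ℝ} (h : Uicx u) :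
    ConvexOn ℝ Set.univ (fun t : ℝ => u (max t 0)) := by
  obtain ⟨hm, hc, -, -⟩ := h
  refine ⟨convex_univ, ?_⟩
  intro x _ y _ a b ha hb hab
  have hx : max x 0 ∈ Set.Ici (0:ℝ) := Set.mem_Ici.2 (le_max_right _ _)
  have hy : max y 0 ∈ Set.Ici (0:ℝ) := Set.mem_Ici.2 (le_max_right _ _)
  refine le_trans (hm.monotoneOn (Set.mem_Ici.2 (le_max_right _ _))
    (hc.1 hx hy ha hb hab) ?_) (hc.2 hx hy ha hb hab)
  simp only [smul_eq_mul]
  apply max_le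
  · exact add_le_add (mul_le_mul_of_nonneg_left (le_max_left _ _) ha)
      (mul_le_mul_of_nonneg_left (le_max_left _ _) hb)
  · have := mul_nonneg ha (le_max_right x 0)
    have := mul_nonneg hb (le_max_right y 0)
    linarith

theorem gpart_cont {u : ℝ → ℝ} (h : Uicx u) :
    Continuous (fun t : ℝ => u (max t 0)) :=
  continuousOn_univ.1 ((gpart_convex h).continuousOn isOpen_univ)

theorem phi_cont {u1 u2 : ℝ → ℝ} (h1 : Uicx u1) (h2 : Uicx u2) (α : ℝ) :
    Continuous (phiFun u1 u2 α) := by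
  have a := gpart_cont h1
  have b := (gpart_cont h2).comp (continuous_neg (G := ℝ))
  exact (continuous_const.mul a).add (continuous_const.mul b)

theorem phi_convex {u1 u2 : ℝ → ℝ} (h1 : Uicx u1) (h2 : Uicx u2) {α : ℝ}
    (hα : α ∈ Set.Ioo (0:ℝ) 1) : ConvexOn ℝ Set.univ (phiFun u1 u2 α) := by
  have a := gpart_convex h1
  have b := gpart_convex h2
  refine ⟨convex_univ, ?_⟩
  intro x _ y _ p q hp hq hpq
  have A := a.2 (mem_univ x) (mem_univ y) hp hq hpq
  have B := b.2 (mem_univ (-x)) (mem_univ (-y)) hp hq hpq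
  simp only [smul_eq_mul] at A B ⊢
  unfold phiFun
  rw [show p * -x + q * -y = -(p * x + q * y) by ring] at B
  have A' := mul_le_mul_of_nonneg_left A hα.1.le
  have B' := mul_le_mul_of_nonneg_left B (sub_nonneg.2 hα.2.le)
  linarith

theorem convex_four {f : ℝ → ℝ} (hf : ConvexOn ℝ Set.univ f) {a b c d : ℝ}
    (hab : a ≤ b) (hac : a ≤ c) (hsum : b + c = a + d) : f b + f c ≤ f a + f d := by
  rcases eq_or_lt_of_le (show a ≤ d by linarith) with h | h
  · have : b = a := by linarith
    have : c = a := by linarith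
    subst_vars; simp
  · have hd : 0 < d - a := by linarith
    have hd' := hd.ne'
    have H : ∀ e, a ≤ e → e ≤ d → f e ≤ ((d - e) / (d - a)) * f a + ((e - a) / (d - a)) * f d := by
      intro e h1 h2
      have := hf.2 (mem_univ a) (mem_univ d)
        (show 0 ≤ (d - e) / (d - a) from div_nonneg (by linarith) hd.le)
        (show 0 ≤ (e - a) / (d - a) from div_nonneg (by linarith) hd.le) (by field_simp; ring)
      simp only [smul_eq_mul] at this
      have he : (d - e) / (d - a) * a + (e - a) / (d - a) * d = e := by
        field_simp; ring
      rwa [he] at this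
    have B := H b hab (by linarith)
    have C := H c hac (by linarith)
    have e1 : (d - b) / (d - a) + (d - c) / (d - a) = 1 := by
      field_simp; linarith
    have e2 : (b - a) / (d - a) + (c - a) / (d - a) = 1 := by
      field_simp; linarith
    calc f b + f c ≤ ((d - b) / (d - a) + (d - c) / (d - a)) * f a
          + ((b - a) / (d - a) + (c - a) / (d - a)) * f d := by linarith
      _ = _ := by rw [e1, e2]; ring

theorem phi_lt_pos {u1 u2 : ℝ → ℝ} (h1 : Uicx u1) {α : ℝ}
    (hα : α ∈ Set.Ioo (0:ℝ) 1) {s t : ℝ} (hs : 0 ≤ s) (hst : s < t) :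
    phiFun u1 u2 α s < phiFun u1 u2 α t := by
  unfold phiFun
  rw [max_eq_left hs, max_eq_left (hs.trans hst.le), max_eq_right (by linarith : -s ≤ 0),
    max_eq_right (by linarith : -t ≤ 0)]
  have := h1.1 (show s ∈ Set.Ici (0:ℝ) from hs) (show t ∈ Set.Ici (0:ℝ) from hs.trans hst.le) hst
  have := mul_lt_mul_of_pos_left this hα.1
  linarith

theorem phi_lt_neg {u1 u2 : ℝ → ℝ} (h2 : Uicx u2) {α : ℝ}
    (hα : α ∈ Set.Ioo (0:ℝ) 1) {s t : ℝ} (hs : s ≤ 0) (hst : t < s) :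
    phiFun u1 u2 α s < phiFun u1 u2 α t := by
  unfold phiFun
  rw [max_eq_right hs, max_eq_right (hst.le.trans hs), max_eq_left (by linarith : 0 ≤ -s),
    max_eq_left (by linarith : 0 ≤ -t)]
  have := h2.1 (show -s ∈ Set.Ici (0:ℝ) by simpa using hs)
    (show -t ∈ Set.Ici (0:ℝ) by simpa using hst.le.trans hs) (neg_lt_neg hst)
  have := mul_lt_mul_of_pos_left this (sub_pos.2 hα.2)
  linarith

theorem bddMeas_mono {𝒢 mΩ : MeasurableSpace Ω} (hG : 𝒢 ≤ mΩ) {Z : Ω → ℝ}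
    (h : BddMeas 𝒢 Z) : BddMeas mΩ Z := ⟨h.1.mono hG le_rfl, h.2⟩

theorem integrable_comp_cont {mΩ : MeasurableSpace Ω} (P : Measure Ω) [IsProbabilityMeasure P]
    {f : ℝ → ℝ} (hf : Continuous f) {X Z : Ω → ℝ} (hX : BddMeas mΩ X) (hZ : BddMeas mΩ Z) :
    Integrable (fun ω => f (X ω - Z ω)) P := by
  obtain ⟨hXm, C, hC⟩ := hX
  obtain ⟨hZm, D, hD⟩ := hZ
  obtain ⟨M, hM⟩ := (isCompact_Icc (a := -(C + D)) (b := C + D)).exists_bound_of_continuousOn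
    hf.continuousOn
  refine Integrable.of_bound (hf.measurable.comp (hXm.sub hZm)).aestronglyMeasurable M
    (Eventually.of_forall fun ω => hM _ ?_)
  have h1 := abs_le.1 (hC ω)
  have h2 := abs_le.1 (hD ω)
  constructor <;> linarith [h1.1, h1.2, h2.1, h2.2]

theorem piRisk_eq {mΩ : MeasurableSpace Ω} (P : Measure Ω) [IsProbabilityMeasure P]
    {u1 u2 : ℝ → ℝ} (h1 : Uicx u1) (h2 : Uicx u2) (α : ℝ)
    {X Z : Ω → ℝ} (hX : BddMeas mΩ X) (hZ : BddMeas mΩ Z) :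
    piRisk P u1 u2 α X Z = ∫ ω, phiFun u1 u2 α (X ω - Z ω) ∂P := by
  unfold piRisk phiFun
  have i1 := integrable_comp_cont P (gpart_cont h1) hX hZ
  have i2 := integrable_comp_cont P (gpart_cont h2) hZ hX
  simp only [neg_sub]
  rw [integral_add (i1.const_mul α) (i2.const_mul (1 - α)), integral_const_mul,
    integral_const_mul]

theorem bddMeas_min {𝒢 : MeasurableSpace Ω} {Z W : Ω → ℝ} (hZ : BddMeas 𝒢 Z)
    (hW : BddMeas 𝒢 W) : BddMeas 𝒢 (fun ω => min (Z ω) (W ω)) := by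
  obtain ⟨a, C, hC⟩ := hZ
  obtain ⟨b, D, hD⟩ := hW
  refine ⟨a.min b, max C D, fun ω => ?_⟩
  beta_reduce
  rcases min_choice (Z ω) (W ω) with h | h <;> rw [h]
  · exact (hC ω).trans (le_max_left _ _)
  · exact (hD ω).trans (le_max_right _ _)

theorem bddMeas_max {𝒢 : MeasurableSpace Ω} {Z W : Ω → ℝ} (hZ : BddMeas 𝒢 Z)
    (hW : BddMeas 𝒢 W) : BddMeas 𝒢 (fun ω => max (Z ω) (W ω)) := by
  obtain ⟨a, C, hC⟩ := hZ
  obtain ⟨b, D, hD⟩ := hW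
  refine ⟨a.max b, max C D, fun ω => ?_⟩
  beta_reduce
  rcases max_choice (Z ω) (W ω) with h | h <;> rw [h]
  · exact (hC ω).trans (le_max_left _ _)
  · exact (hD ω).trans (le_max_right _ _)

theorem argmin_min {𝒢 mΩ : MeasurableSpace Ω} (P : Measure Ω) [IsProbabilityMeasure P]
    (hG : 𝒢 ≤ mΩ) {u1 u2 : ℝ → ℝ} (h1 : Uicx u1) (h2 : Uicx u2)
    {α : ℝ} (hα : α ∈ Set.Ioo (0:ℝ) 1) {X Y Z W : Ω → ℝ}
    (hX : BddMeas mΩ X) (hY : BddMeas mΩ Y) (hXY : X ≤ᵐ[P] Y)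
    (hZ : Z ∈ ArgminSet P 𝒢 u1 u2 α X) (hW : W ∈ ArgminSet P 𝒢 u1 u2 α Y) :
    (fun ω => min (Z ω) (W ω)) ∈ ArgminSet P 𝒢 u1 u2 α X := by
  have bmin := bddMeas_min hZ.1 hW.1
  have bmax := bddMeas_max hZ.1 hW.1
  refine ⟨bmin, fun V hV => le_trans ?_ (hZ.2 V hV)⟩
  have key := hW.2 _ bmax
  have hc := phi_cont h1 h2 α
  have m := @bddMeas_mono Ω 𝒢 mΩ hG
  rw [piRisk_eq P h1 h2 α hY (m hW.1), piRisk_eq P h1 h2 α hY (m bmax)] at key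
  rw [piRisk_eq P h1 h2 α hX (m bmin), piRisk_eq P h1 h2 α hX (m hZ.1)]
  have iXm := integrable_comp_cont P hc hX (m bmin)
  have iYM := integrable_comp_cont P hc hY (m bmax)
  have iXZ := integrable_comp_cont P hc hX (m hZ.1)
  have iYW := integrable_comp_cont P hc hY (m hW.1)
  have main := integral_mono_ae (iXm.add iYM) (iXZ.add iYW) (by
    filter_upwards [hXY] with ω hω
    simp only [Pi.add_apply]
    rcases le_total (Z ω) (W ω) with h | h
    · rw [min_eq_left h, max_eq_right h]
    · rw [min_eq_right h, max_eq_left h]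
      have := convex_four (phi_convex h1 h2 hα) (a := X ω - Z ω) (b := X ω - W ω)
        (c := Y ω - Z ω) (d := Y ω - W ω) (by linarith) (by linarith) (by ring)
      exact this)
  rw [integral_add' iXm iYM, integral_add' iXZ iYW] at main
  linarith

/-- Truncation to `[-C, C]`. -/
noncomputable def truncFun (C z : ℝ) : ℝ := max (-C) (min C z)

theorem abs_truncFun {C : ℝ} (hC : 0 ≤ C) (z : ℝ) : |truncFun C z| ≤ C := by
  unfold truncFun
  rw [abs_le]
  exact ⟨le_max_left _ _, max_le (by linarith) (min_le_left _ _)⟩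

theorem phi_trunc_lt {u1 u2 : ℝ → ℝ} (h1 : Uicx u1) (h2 : Uicx u2) {α : ℝ}
    (hα : α ∈ Set.Ioo (0:ℝ) 1) {C x z : ℝ} (hx : |x| ≤ C) (hz : truncFun C z ≠ z) :
    phiFun u1 u2 α (x - truncFun C z) < phiFun u1 u2 α (x - z) := by
  obtain ⟨ha, hb⟩ := abs_le.1 hx
  unfold truncFun at *
  rcases lt_trichotomy z (-C) with h | h | h
  · rw [min_eq_right (by linarith), max_eq_left h.le]
    exact phi_lt_pos h1 hα (by linarith) (by linarith)
  · exact absurd (by rw [min_eq_right (by linarith), max_eq_right h.ge]) hz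
  · rcases le_or_gt z C with h' | h'
    · exact absurd (by rw [min_eq_right h', max_eq_right h.le]) hz
    · rw [min_eq_left h'.le, max_eq_right (by linarith)]
      exact phi_lt_neg h2 hα (by linarith) (by linarith)

theorem argmin_trunc {𝒢 mΩ : MeasurableSpace Ω} (P : Measure Ω) [IsProbabilityMeasure P]
    (hG : 𝒢 ≤ mΩ) {u1 u2 : ℝ → ℝ} (h1 : Uicx u1) (h2 : Uicx u2)
    {α : ℝ} (hα : α ∈ Set.Ioo (0:ℝ) 1) {X Z : Ω → ℝ} {C : ℝ} (hC : 0 ≤ C)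
    (hX : BddMeas mΩ X) (hXC : ∀ᵐ ω ∂P, |X ω| ≤ C)
    (hZ : Z ∈ ArgminSet P 𝒢 u1 u2 α X) :
    (fun ω => truncFun C (Z ω)) ∈ ArgminSet P 𝒢 u1 u2 α X ∧
      ∀ᵐ ω ∂P, truncFun C (Z ω) = Z ω := by
  have bt : BddMeas 𝒢 (fun ω => truncFun C (Z ω)) :=
    ⟨Measurable.max measurable_const (Measurable.min measurable_const hZ.1.1), C,
      fun ω => abs_truncFun hC _⟩
  have m := @bddMeas_mono Ω 𝒢 mΩ hG
  have hc := phi_cont h1 h2 α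
  have it := integrable_comp_cont P hc hX (m bt)
  have iZ := integrable_comp_cont P hc hX (m hZ.1)
  have hle : ∀ᵐ ω ∂P, phiFun u1 u2 α (X ω - truncFun C (Z ω)) ≤ phiFun u1 u2 α (X ω - Z ω) := by
    filter_upwards [hXC] with ω hω
    by_cases h : truncFun C (Z ω) = Z ω
    · rw [h]
    · exact (phi_trunc_lt h1 h2 hα hω h).le
  have I1 := integral_mono_ae it iZ hle
  have I2 := hZ.2 _ bt
  have e1 := piRisk_eq P h1 h2 α hX (m hZ.1)
  have e2 := piRisk_eq P h1 h2 α hX (m bt)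
  refine ⟨⟨bt, fun V hV => le_trans (by rw [e1, e2]; exact I1) (hZ.2 V hV)⟩, ?_⟩
  rw [e1, e2] at I2
  have heq := (integral_eq_iff_of_ae_le it iZ hle).1 (le_antisymm I1 I2)
  filter_upwards [heq, hXC] with ω hω hx
  by_contra h
  exact (phi_trunc_lt h1 h2 hα hx h).ne hω

theorem tendsto_piRisk {mΩ : MeasurableSpace Ω} (P : Measure Ω) [IsProbabilityMeasure P]
    {u1 u2 : ℝ → ℝ} (h1 : Uicx u1) (h2 : Uicx u2) (α : ℝ)
    {X Z : Ω → ℝ} {Xs Zs : ℕ → Ω → ℝ} {C D : ℝ}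
    (hX : BddMeas mΩ X) (hZ : BddMeas mΩ Z)
    (hXs : ∀ n, BddMeas mΩ (Xs n)) (hZs : ∀ n, BddMeas mΩ (Zs n))
    (hC : ∀ n, ∀ᵐ ω ∂P, |Xs n ω| ≤ C) (hD : ∀ n, ∀ᵐ ω ∂P, |Zs n ω| ≤ D)
    (hXl : ∀ᵐ ω ∂P, Tendsto (fun n => Xs n ω) atTop (𝓝 (X ω)))
    (hZl : ∀ᵐ ω ∂P, Tendsto (fun n => Zs n ω) atTop (𝓝 (Z ω))) :
    Tendsto (fun n => piRisk P u1 u2 α (Xs n) (Zs n)) atTop (𝓝 (piRisk P u1 u2 α X Z)) := by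
  have hc := phi_cont h1 h2 α
  rw [piRisk_eq P h1 h2 α hX hZ]
  simp_rw [fun n => piRisk_eq P h1 h2 α (hXs n) (hZs n)]
  obtain ⟨M, hM⟩ := (isCompact_Icc (a := -(C + D)) (b := C + D)).exists_bound_of_continuousOn
    hc.continuousOn
  refine tendsto_integral_of_dominated_convergence (fun _ => M)
    (fun n => (integrable_comp_cont P hc (hXs n) (hZs n)).aestronglyMeasurable)
    (integrable_const M) (fun n => ?_) ?_
  · filter_upwards [hC n, hD n] with ω a b
    apply hM
    have h1 := abs_le.1 a
    have h2 := abs_le.1 b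
    constructor <;> linarith [h1.1, h1.2, h2.1, h2.2]
  · filter_upwards [hXl, hZl] with ω a b
    exact (hc.tendsto _).comp (a.sub b)

theorem argmin_closed {𝒢 mΩ : MeasurableSpace Ω} (P : Measure Ω) [IsProbabilityMeasure P]
    (hG : 𝒢 ≤ mΩ) {u1 u2 : ℝ → ℝ} (h1 : Uicx u1) (h2 : Uicx u2) {α : ℝ}
    {X Z : Ω → ℝ} {Xs Zs : ℕ → Ω → ℝ} {C : ℝ}
    (hX : BddMeas mΩ X) (hZ : BddMeas 𝒢 Z)
    (hXs : ∀ n, BddMeas mΩ (Xs n)) (hZs : ∀ n, Zs n ∈ ArgminSet P 𝒢 u1 u2 α (Xs n))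
    (hC : ∀ n, ∀ᵐ ω ∂P, |Xs n ω| ≤ C) (hD : ∀ n, ∀ᵐ ω ∂P, |Zs n ω| ≤ C)
    (hXl : ∀ᵐ ω ∂P, Tendsto (fun n => Xs n ω) atTop (𝓝 (X ω)))
    (hZl : ∀ᵐ ω ∂P, Tendsto (fun n => Zs n ω) atTop (𝓝 (Z ω))) :
    Z ∈ ArgminSet P 𝒢 u1 u2 α X := by
  have m := @bddMeas_mono Ω 𝒢 mΩ hG
  refine ⟨hZ, fun W hW => ?_⟩
  obtain ⟨D, hWD⟩ := hW.2
  have t1 := tendsto_piRisk P h1 h2 α hX (m hZ) hXs (fun n => m (hZs n).1) hC hD hXl hZl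
  have t2 := tendsto_piRisk P h1 h2 α hX (m hW) hXs (Zs := fun _ => W) (fun n => m hW) hC
    (fun n => Eventually.of_forall hWD) hXl (Eventually.of_forall fun ω => tendsto_const_nhds)
  exact le_of_tendsto_of_tendsto' t1 t2 fun n => (hZs n).2 W hW

theorem essInf_attained {𝒢 mΩ : MeasurableSpace Ω} (P : Measure Ω) [IsProbabilityMeasure P]
    (hG : 𝒢 ≤ mΩ) {u1 u2 : ℝ → ℝ} (h1 : Uicx u1) (h2 : Uicx u2)
    {α : ℝ} (hα : α ∈ Set.Ioo (0:ℝ) 1) {X ρ : Ω → ℝ} {C : ℝ} (hC : 0 ≤ C)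
    (hX : BddMeas mΩ X) (hXC : ∀ᵐ ω ∂P, |X ω| ≤ C)
    (hρ : IsEssInf P (ArgminSet P 𝒢 u1 u2 α X) ρ) :
    ∃ Y ∈ ArgminSet P 𝒢 u1 u2 α X, (∀ ω, |Y ω| ≤ C) ∧ Y =ᵐ[P] ρ := by
  have m := @bddMeas_mono Ω 𝒢 mΩ hG
  have hint : ∀ Z, BddMeas 𝒢 Z → Integrable Z P := by
    intro Z hZ
    obtain ⟨hm, D, hD⟩ := m hZ
    exact Integrable.of_bound hm.aestronglyMeasurable D (Eventually.of_forall hD)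
  have hne : (ArgminSet P 𝒢 u1 u2 α X).Nonempty := by
    by_contra h
    rw [Set.not_nonempty_iff_eq_empty] at h
    have := hρ.2 (fun ω => ρ ω + 1) (by rw [h]; simp)
    obtain ⟨ω, hω⟩ := this.exists
    linarith
  set T : Set (Ω → ℝ) := {Z | Z ∈ ArgminSet P 𝒢 u1 u2 α X ∧ ∀ ω, |Z ω| ≤ C} with hT
  have hTmin : ∀ Z ∈ T, ∀ W ∈ T, (fun ω => min (Z ω) (W ω)) ∈ T := by
    intro Z hZ W hW
    refine ⟨argmin_min P hG h1 h2 hα hX hX (Eventually.of_forall fun _ => le_rfl) hZ.1 hW.1, fun ω => ?_⟩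
    rcases min_choice (Z ω) (W ω) with h | h
    · simpa only [h] using hZ.2 ω
    · simpa only [h] using hW.2 ω
  have hTne : T.Nonempty := by
    obtain ⟨Z, hZ⟩ := hne
    exact ⟨_, (argmin_trunc P hG h1 h2 hα hC hX hXC hZ).1, fun ω => abs_truncFun hC _⟩
  set I : Set ℝ := (fun Z : Ω → ℝ => ∫ ω, Z ω ∂P) '' T with hI
  have hIbdd : BddBelow I := by
    refine ⟨-C, ?_⟩
    rintro _ ⟨Z, hZ, rfl⟩
    have := integral_mono (integrable_const (μ := P) (-C)) (hint Z hZ.1.1)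
      (fun ω => (abs_le.1 (hZ.2 ω)).1)
    simpa using this
  have hIne : I.Nonempty := hTne.image _
  have hex : ∀ k : ℕ, ∃ Z ∈ T, ∫ ω, Z ω ∂P < sInf I + 1 / ((k : ℝ) + 1) := by
    intro k
    obtain ⟨_, ⟨Z, hZ, rfl⟩, h⟩ := exists_lt_of_csInf_lt hIne
      (show sInf I < sInf I + 1 / ((k : ℝ) + 1) by
        have : (0:ℝ) < 1 / ((k : ℝ) + 1) := by positivity
        linarith)
    exact ⟨Z, hZ, h⟩
  choose Zs hZsT hZslt using hex
  let Ys : ℕ → Ω → ℝ := fun k => Nat.rec (Zs 0) (fun j Y ω => min (Y ω) (Zs (j + 1) ω)) k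
  have hYs : ∀ k, Ys (k + 1) = fun ω => min (Ys k ω) (Zs (k + 1) ω) := fun k => rfl
  have hYT : ∀ k, Ys k ∈ T := by
    intro k
    induction k with
    | zero => exact hZsT 0
    | succ k ih => rw [hYs]; exact hTmin _ ih _ (hZsT _)
  have hYZ : ∀ k ω, Ys k ω ≤ Zs k ω := by
    intro k ω
    cases k with
    | zero => exact le_rfl
    | succ k => rw [hYs]; exact min_le_right _ _
  have hanti : ∀ ω, Antitone fun k => Ys k ω := fun ω =>
    antitone_nat_of_succ_le fun k => by rw [hYs]; exact min_le_left _ _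
  have hbdd : ∀ ω, BddBelow (Set.range fun k => Ys k ω) := by
    intro ω
    refine ⟨-C, ?_⟩
    rintro _ ⟨k, rfl⟩
    exact (abs_le.1 ((hYT k).2 ω)).1
  let Y : Ω → ℝ := fun ω => ⨅ k, Ys k ω
  have hlim : ∀ ω, Tendsto (fun k => Ys k ω) atTop (𝓝 (Y ω)) := fun ω =>
    tendsto_atTop_ciInf (hanti ω) (hbdd ω)
  have hYC : ∀ ω, |Y ω| ≤ C := fun ω =>
    le_of_tendsto' (hlim ω).abs fun k => (hYT k).2 ω
  have hYm : BddMeas 𝒢 Y := ⟨Measurable.iInf fun k => (hYT k).1.1.1, C, hYC⟩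
  have hYarg : Y ∈ ArgminSet P 𝒢 u1 u2 α X :=
    argmin_closed P hG h1 h2 hX hYm (Xs := fun _ => X) (fun _ => hX) (fun k => (hYT k).1)
      (fun _ => hXC) (fun k => Eventually.of_forall (hYT k).2)
      (Eventually.of_forall fun ω => tendsto_const_nhds) (Eventually.of_forall hlim)
  have hYint : ∫ ω, Y ω ∂P ≤ sInf I := by
    have ht : Tendsto (fun k : ℕ => sInf I + 1 / ((k : ℝ) + 1)) atTop (𝓝 (sInf I + 0)) :=
      tendsto_const_nhds.add tendsto_one_div_add_atTop_nhds_zero_nat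
    rw [add_zero] at ht
    refine ge_of_tendsto' ht fun k => le_trans ?_ (hZslt k).le
    exact integral_mono (hint _ hYm) (hint _ (hZsT k).1.1)
      (fun ω => (ciInf_le (hbdd ω) k).trans (hYZ k ω))
  refine ⟨Y, hYarg, hYC, ?_⟩
  have hlow : ∀ Z ∈ ArgminSet P 𝒢 u1 u2 α X, Y ≤ᵐ[P] Z := by
    intro Z hZ
    obtain ⟨ht, he⟩ := argmin_trunc P hG h1 h2 hα hC hX hXC hZ
    have hmT := hTmin Y ⟨hYarg, hYC⟩ _ ⟨ht, fun ω => abs_truncFun hC _⟩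
    have hle := csInf_le hIbdd (Set.mem_image_of_mem (fun Z : Ω → ℝ => ∫ ω, Z ω ∂P) hmT)
    have hpt : ∀ᵐ ω ∂P, min (Y ω) (truncFun C (Z ω)) ≤ Y ω :=
      Eventually.of_forall fun ω => min_le_left _ _
    have i1 := hint _ hmT.1.1
    have i2 := hint _ hYm
    have heq := (integral_eq_iff_of_ae_le i1 i2 hpt).1
      (le_antisymm (integral_mono_ae i1 i2 hpt) (hYint.trans hle))
    filter_upwards [heq, he] with ω a b
    rw [← b]
    exact min_eq_left_iff.1 a
  filter_upwards [hρ.1 Y hYarg, hρ.2 Y hlow] with ω a b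
  exact le_antisymm b a


/-- Theorem 6.1 (ii): the conditional generalized quantile is continuous
from below: if `Xn ↑ X` a.s., then `ρ_α^𝒢(Xn) ↑ ρ_α^𝒢(X)` a.s. -/
theorem conditional_generalized_quantile_continuous_from_below
    [mΩ : MeasurableSpace Ω] (P : Measure Ω) [IsProbabilityMeasure P]
    (hP : Nonatomic P) (𝒢 : MeasurableSpace Ω) (hG : 𝒢 ≤ mΩ)
    {u1 u2 : ℝ → ℝ} (h1 : Uicx u1) (h2 : Uicx u2)
    {α : ℝ} (hα : α ∈ Set.Ioo (0:ℝ) 1)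
    (X : Ω → ℝ) (hX : BddMeas mΩ X)
    (Xseq : ℕ → Ω → ℝ) (hXn : ∀ n, BddMeas mΩ (Xseq n))
    (hmono : ∀ᵐ ω ∂P, Monotone fun n => Xseq n ω)
    (hlim : ∀ᵐ ω ∂P, Filter.Tendsto (fun n => Xseq n ω) Filter.atTop (nhds (X ω)))
    (ρseq : ℕ → Ω → ℝ) (ρ : Ω → ℝ)
    (hρn : ∀ n, IsEssInf P (ArgminSet P 𝒢 u1 u2 α (Xseq n)) (ρseq n))
    (hρ : IsEssInf P (ArgminSet P 𝒢 u1 u2 α X) ρ) :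
    (∀ᵐ ω ∂P, Monotone fun n => ρseq n ω) ∧
    (∀ᵐ ω ∂P, Filter.Tendsto (fun n => ρseq n ω) Filter.atTop (nhds (ρ ω))) := by
  have mono_gen : ∀ (A B a b : Ω → ℝ), BddMeas mΩ A → BddMeas mΩ B → A ≤ᵐ[P] B →
      IsEssInf P (ArgminSet P 𝒢 u1 u2 α A) a → IsEssInf P (ArgminSet P 𝒢 u1 u2 α B) b →
      (∃ Z, Z ∈ ArgminSet P 𝒢 u1 u2 α A) → a ≤ᵐ[P] b := by
    intro A B a b hA hB hAB ha hb ⟨Z, hZ⟩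
    refine hb.2 a fun W hW => ?_
    filter_upwards [ha.1 _ (argmin_min P hG h1 h2 hα hA hB hAB hZ hW)] with ω hω
    exact hω.trans (min_le_right _ _)
  obtain ⟨C1, hC1⟩ := hX.2
  obtain ⟨C2, hC2⟩ := (hXn 0).2
  set C : ℝ := max 0 (max C1 C2) with hCdef
  have hC : 0 ≤ C := le_max_left _ _
  have hC1' : C1 ≤ C := (le_max_left _ _).trans (le_max_right _ _)
  have hC2' : C2 ≤ C := (le_max_right _ _).trans (le_max_right _ _)
  have hle : ∀ n, Xseq n ≤ᵐ[P] X := fun n => by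
    filter_upwards [hmono, hlim] with ω a b
    exact a.ge_of_tendsto b n
  have hbd : ∀ n, ∀ᵐ ω ∂P, |Xseq n ω| ≤ C := fun n => by
    filter_upwards [hmono, hle n] with ω a b
    have h0 : Xseq 0 ω ≤ Xseq n ω := a (Nat.zero_le n)
    have c1 := abs_le.1 (hC1 ω)
    have c2 := abs_le.1 (hC2 ω)
    exact abs_le.2 ⟨by linarith [c2.1], by linarith [c1.2]⟩
  have hatt := fun n => essInf_attained P hG h1 h2 hα hC (hXn n) (hbd n) (hρn n)
  choose Z hZarg hZC hZρ using hatt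
  have hM : ∀ᵐ ω ∂P, Monotone fun n => ρseq n ω := by
    have : ∀ n, ρseq n ≤ᵐ[P] ρseq (n + 1) := fun n =>
      mono_gen _ _ _ _ (hXn n) (hXn (n + 1)) (by
        filter_upwards [hmono] with ω a
        exact a (Nat.le_succ n)) (hρn n) (hρn (n + 1)) ⟨_, hZarg n⟩
    filter_upwards [ae_all_iff.2 this] with ω hω
    exact monotone_nat_of_le_succ hω
  refine ⟨hM, ?_⟩
  have hup : ∀ n, ρseq n ≤ᵐ[P] ρ := fun n =>
    mono_gen _ _ _ _ (hXn n) hX (hle n) (hρn n) hρ ⟨_, hZarg n⟩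
  have hbdd : ∀ ω, BddAbove (Set.range fun k => Z k ω) := by
    intro ω
    refine ⟨C, ?_⟩
    rintro _ ⟨k, rfl⟩
    exact (abs_le.1 (hZC k ω)).2
  let L : Ω → ℝ := fun ω => ⨆ k, Z k ω
  have hLC : ∀ ω, |L ω| ≤ C := fun ω => abs_le.2
    ⟨(abs_le.1 (hZC 0 ω)).1.trans (le_ciSup (hbdd ω) 0),
      ciSup_le fun k => (abs_le.1 (hZC k ω)).2⟩
  have hLm : BddMeas 𝒢 L := ⟨Measurable.iSup fun k => (hZarg k).1.1, C, hLC⟩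
  have hZl : ∀ᵐ ω ∂P, Tendsto (fun n => Z n ω) atTop (𝓝 (L ω)) := by
    filter_upwards [hM, ae_all_iff.2 hZρ] with ω a b
    refine tendsto_atTop_ciSup (fun i j hij => ?_) (hbdd ω)
    have := a hij
    simp only [← b] at this
    exact this
  have hLarg : L ∈ ArgminSet P 𝒢 u1 u2 α X :=
    argmin_closed P hG h1 h2 hX hLm hXn hZarg hbd
      (fun k => Eventually.of_forall (hZC k)) hlim hZl
  filter_upwards [hZl, ae_all_iff.2 hZρ, ae_all_iff.2 hup, hρ.1 L hLarg] with ω a b c d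
  simp only [b] at a
  have : L ω = ρ ω := le_antisymm (le_of_tendsto' a c) d
  rwa [this] at a
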